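/- Let L be a finite-dimensional p-nilpotent abelian restricted Lie algebra over a perfect field F of characteristic p > 0, and let H be a restricted Lie algebra over F such that u(L) ≅ u(H) as F-algebras. Then L ≅ H as restricted Lie algebras. -/

import Mathlib

open UniversalEnvelopingAlgebra

attribute [local instance 100] LieRing.ofAssociativeRing

/-- A restricted Lie algebra over a field `F` of characteristic `p`: a Lie algebra equipped
with a `p`-map `x ↦ x^[p]` satisfying Jacobson's identities.  The additive identity
`(x+y)^[p] = x^[p] + y^[p] + Σ sᵢ(x,y)` (with `sᵢ` the Jacobson polynomials) is expressed
faithfully inside the universal enveloping algebra, where it reads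
`ι((x+y)^[p]) - ι(x^[p]) - ι(y^[p]) = (ι x + ι y)^p - (ι x)^p - (ι y)^p`. -/
class RestrictedLieAlgebra (p : ℕ) (F : Type*) (L : Type*) [Field F]
    [LieRing L] [LieAlgebra F L] : Type _ where
  pOp : L → L
  pOp_smul : ∀ (a : F) (x : L), pOp (a • x) = a ^ p • pOp x
  ad_pOp : ∀ x y : L, ⁅pOp x, y⁆ = ((LieAlgebra.ad F L x) ^ p) y
  pOp_add : ∀ x y : L,
    ι F (pOp (x + y)) - ι F (pOp x) - ι F (pOp y)
      = (ι F x + ι F y) ^ p - (ι F x) ^ p - (ι F y) ^ p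

namespace RestrictedLieAlgebra

variable (p : ℕ) (F : Type*) [Field F]

section Defs

variable (L : Type*) [LieRing L] [LieAlgebra F L] [RestrictedLieAlgebra p F L]

/-- The `p`-map of a restricted Lie algebra. -/
abbrev pmap (x : L) : L := RestrictedLieAlgebra.pOp (p := p) (F := F) x

/-- The relation defining the restricted enveloping algebra as a quotient of the
universal enveloping algebra: `x^p = x^[p]` for all `x ∈ L`. -/
def uRel : UniversalEnvelopingAlgebra F L → UniversalEnvelopingAlgebra F L → Prop :=
  fun a b => ∃ x : L, a = (ι F x) ^ p ∧ b = ι F (pmap p F L x)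

/-- The restricted enveloping algebra `u(L)`: the quotient of the universal enveloping
algebra of `L` by the two-sided ideal generated by `{x^p - x^[p] : x ∈ L}`. -/
abbrev uEnv := RingQuot (uRel p F L)

/-- The canonical (linear) embedding `L → u(L)`. -/
def uemb : L →ₗ[F] uEnv p F L :=
  ((RingQuot.mkAlgHom F (uRel p F L)).toLinearMap).comp (ι F : L →ₗ⁅F⁆ _).toLinearMap

variable [Fact p.Prime]

/-- The augmentation map `ε : u(L) → F`, induced by `x ↦ 0` for `x ∈ L`. -/
noncomputable def aug : uEnv p F L →ₐ[F] F :=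
  RingQuot.liftAlgHom F
    ⟨(UniversalEnvelopingAlgebra.lift F) (0 : L →ₗ⁅F⁆ F), by
      rintro a b ⟨x, rfl, rfl⟩
      simp [UniversalEnvelopingAlgebra.lift_ι_apply,
        zero_pow (Nat.Prime.ne_zero (Fact.out : p.Prime))]⟩

/-- The augmentation ideal `ω(L)`, i.e. the kernel of the augmentation map, as a
subspace of `u(L)`. -/
noncomputable def omegaIdeal : Submodule F (uEnv p F L) :=
  LinearMap.ker (aug p F L).toLinearMap

/-- The image of `L` inside `u(L)`. -/
def lSub : Submodule F (uEnv p F L) := LinearMap.range (uemb p F L)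

end Defs

section Closure

variable {L : Type*} [LieRing L] [LieAlgebra F L] [RestrictedLieAlgebra p F L]

/-- The restricted subalgebra generated by a subset `S` of `L`: the smallest Lie
subalgebra containing `S` which is closed under the `p`-map. -/
def restrictedClosure (S : Set L) : LieSubalgebra F L :=
  sInf {K : LieSubalgebra F L | S ⊆ K ∧ ∀ x ∈ K, pmap p F L x ∈ K}

/-- For a subalgebra `N ⊆ L`, the restricted subalgebra `N^p` generated by all
`x^[p]`, `x ∈ N`. -/
def subPPow (K : LieSubalgebra F L) : LieSubalgebra F L :=
  restrictedClosure p F (pmap p F L '' K)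

end Closure

section PNilpotent

variable (L : Type*) [LieRing L] [LieAlgebra F L] [RestrictedLieAlgebra p F L]

/-- `L` is `p`-nilpotent if `L^{pˢ} = 0` for some `s`, where `L^p` denotes the restricted
subalgebra generated by all `x^[p]`. -/
def IsPNilpotent : Prop :=
  ∃ s : ℕ, (subPPow p F)^[s] (⊤ : LieSubalgebra F L) = ⊥

/-- The derived subalgebra `L' = γ₂(L)` as a submodule of `L`. -/
abbrev derivedSub : Submodule F L := (LieModule.lowerCentralSeries F L L 1).toSubmodule

/-- `L'_p`, the restricted subalgebra generated by `L'`, as a submodule. -/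
def derivedP : Submodule F L :=
  (restrictedClosure p F (derivedSub F L : Set L)).toSubmodule

/-- `L'^p + γ₃(L)`, as a submodule of `L`. -/
def mainIdeal : Submodule F L :=
  (subPPow p F (restrictedClosure p F (derivedSub F L : Set L))).toSubmodule
    ⊔ (LieModule.lowerCentralSeries F L L 2).toSubmodule

end PNilpotent

end RestrictedLieAlgebra

namespace MvPolynomial

variable {σ R : Type*} [CommRing R]

/-- The polynomials all of whose monomials have total degree less than `n`. -/
def degreeLT (σ R : Type*) [CommRing R] (n : ℕ) : Submodule R (MvPolynomial σ R) where
  carrier := {g | ∀ γ, coeff γ g ≠ 0 → γ.degree < n}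
  zero_mem' := by simp
  add_mem' := by
    intro a b ha hb γ h
    by_cases h' : coeff γ a = 0
    · exact hb γ (by simpa [h'] using h)
    · exact ha γ h'
  smul_mem' := by
    intro c a ha γ h
    exact ha γ (by rintro h'; simp [h'] at h)

theorem mem_degreeLT {n : ℕ} {g : MvPolynomial σ R} :
    g ∈ degreeLT σ R n ↔ ∀ γ, coeff γ g ≠ 0 → γ.degree < n := Iff.rfl

theorem degreeLT_mono {m n : ℕ} (h : m ≤ n) : degreeLT σ R m ≤ degreeLT σ R n :=
  fun _ hg γ hγ => (hg γ hγ).trans_le h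

theorem mul_mem_degreeLT {m n : ℕ} {a b : MvPolynomial σ R} (ha : a ∈ degreeLT σ R (m + 1))
    (hb : b ∈ degreeLT σ R n) : a * b ∈ degreeLT σ R (m + n) := by
  classical
  intro γ h
  obtain ⟨δ, hδ, ε, hε, rfl⟩ := Finset.mem_add.1 (support_mul a b (mem_support_iff.2 h))
  have h1 := ha δ (mem_support_iff.1 hδ)
  have h2 := hb ε (mem_support_iff.1 hε)
  rw [map_add]
  omega

theorem monomial_mem_degreeLT {γ : σ →₀ ℕ} {r : R} {n : ℕ} (h : γ.degree < n) :
    monomial γ r ∈ degreeLT σ R n := by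
  classical
  intro δ hδ
  rw [coeff_monomial] at hδ
  split_ifs at hδ with h'
  · rwa [← h']
  · exact absurd rfl hδ

/-- `u` has `X ^ γ` as its unique monomial of top degree. -/
def HasLeading (γ : σ →₀ ℕ) (u : MvPolynomial σ R) : Prop :=
  u - monomial γ 1 ∈ degreeLT σ R γ.degree

theorem HasLeading.mem_degreeLT {γ : σ →₀ ℕ} {u : MvPolynomial σ R} (h : HasLeading γ u) :
    u ∈ degreeLT σ R (γ.degree + 1) := by
  have := add_mem (degreeLT_mono (Nat.le_succ _) h)
    (monomial_mem_degreeLT (r := (1 : R)) (Nat.lt_succ_self γ.degree))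
  simpa using this

theorem hasLeading_one : HasLeading (0 : σ →₀ ℕ) (1 : MvPolynomial σ R) := by
  have h : (1 : MvPolynomial σ R) - monomial 0 1 = 0 := by simp
  rw [HasLeading, h]
  exact zero_mem _

theorem HasLeading.mul {γ δ : σ →₀ ℕ} {u v : MvPolynomial σ R} (hu : HasLeading γ u)
    (hv : HasLeading δ v) : HasLeading (γ + δ) (u * v) := by
  have h : u * v - monomial (γ + δ) 1
      = u * (v - monomial δ 1) + monomial δ 1 * (u - monomial γ 1) := by
    have : (monomial (γ + δ) (1 : R)) = monomial γ 1 * monomial δ 1 := by simp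
    rw [this]
    ring
  rw [HasLeading, h, map_add]
  refine add_mem (mul_mem_degreeLT hu.mem_degreeLT hv) ?_
  rw [add_comm γ.degree]
  exact mul_mem_degreeLT (monomial_mem_degreeLT (Nat.lt_succ_self _)) hu

theorem HasLeading.pow {γ : σ →₀ ℕ} {u : MvPolynomial σ R} (hu : HasLeading γ u) (n : ℕ) :
    HasLeading (n • γ) (u ^ n) := by
  induction n with
  | zero => simpa using hasLeading_one
  | succ n ih => rw [pow_succ, succ_nsmul]; exact ih.mul hu

theorem HasLeading.prod {ι : Type*} (s : Finset ι) {γ : ι → σ →₀ ℕ} {u : ι → MvPolynomial σ R}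
    (h : ∀ i ∈ s, HasLeading (γ i) (u i)) : HasLeading (∑ i ∈ s, γ i) (∏ i ∈ s, u i) := by
  classical
  induction s using Finset.induction_on with
  | empty => simpa using hasLeading_one
  | insert i s hi ih =>
    rw [Finset.sum_insert hi, Finset.prod_insert hi]
    exact (h i (by simp)).mul (ih fun j hj => h j (by simp [hj]))

theorem hasLeading_X (j : σ) : HasLeading (Finsupp.single j 1) (X j : MvPolynomial σ R) := by
  rw [HasLeading, X, sub_self]
  exact zero_mem _

section PowerReduction

variable (p : ℕ) (l : σ → MvPolynomial σ R)

/-- The product of `(X j ^ p - l j) ^ (γ j / p) * X j ^ (γ j % p)` over all `j`. -/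
noncomputable def powMonomial (γ : σ →₀ ℕ) : MvPolynomial σ R :=
  γ.prod fun j n => (X j ^ p - l j) ^ (n / p) * X j ^ (n % p)

/-- The linear map sending `X ^ γ` to `powMonomial p l γ`. -/
noncomputable def powMap : MvPolynomial σ R →ₗ[R] MvPolynomial σ R :=
  (basisMonomials σ R).constr R (powMonomial p l)

theorem powMap_monomial (γ : σ →₀ ℕ) : powMap p l (monomial γ 1) = powMonomial p l γ := by
  have h : monomial γ (1 : R) = basisMonomials σ R γ := by rw [coe_basisMonomials]
  rw [powMap, h, Module.Basis.constr_basis]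

variable {p l}

theorem hasLeading_powMonomial (hl : ∀ j, l j ∈ degreeLT σ R p) (γ : σ →₀ ℕ) :
    HasLeading γ (powMonomial p l γ) := by
  have hq (j : σ) : HasLeading (Finsupp.single j p) (X j ^ p - l j) := by
    have : (X j ^ p - l j) - monomial (Finsupp.single j p) 1 = - l j := by
      rw [X_pow_eq_monomial]; ring
    rw [HasLeading, this, Finsupp.degree_single]
    exact neg_mem (hl j)
  have := HasLeading.prod (R := R) γ.support (γ := fun j => Finsupp.single j (γ j))
    (u := fun j => (X j ^ p - l j) ^ (γ j / p) * X j ^ (γ j % p)) (by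
      intro j _
      have := ((hq j).pow (γ j / p)).mul ((hasLeading_X (R := R) j).pow (γ j % p))
      rwa [Finsupp.smul_single, Finsupp.smul_single, ← Finsupp.single_add, smul_eq_mul,
        smul_eq_mul, mul_one, Nat.div_add_mod'] at this)
  rwa [show ∑ j ∈ γ.support, Finsupp.single j (γ j) = γ from γ.sum_single] at this

theorem powMap_sub_mem (hl : ∀ j, l j ∈ degreeLT σ R p) {n : ℕ} {g : MvPolynomial σ R}
    (hg : g ∈ degreeLT σ R (n + 1)) : powMap p l g - g ∈ degreeLT σ R n := by
  have key : powMap p l g - g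
      = ∑ γ ∈ g.support, coeff γ g • (powMonomial p l γ - monomial γ 1) := by
    conv_lhs => rw [g.as_sum]
    simp only [map_sum, ← Finset.sum_sub_distrib]
    refine Finset.sum_congr rfl fun γ _ => ?_
    have : monomial γ (coeff γ g) = coeff γ g • monomial γ (1 : R) := by simp [smul_monomial]
    rw [this, map_smul, powMap_monomial, smul_sub]
  rw [key]
  refine sum_mem fun γ hγ => Submodule.smul_mem _ _ ?_
  exact degreeLT_mono (Nat.le_of_lt_succ (hg γ (mem_support_iff.1 hγ)))
    (hasLeading_powMonomial hl γ)

theorem exists_mem_degreeLT (g : MvPolynomial σ R) : ∃ n, g ∈ degreeLT σ R n :=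
  ⟨g.support.sup Finsupp.degree + 1, fun _ hγ =>
    Nat.lt_succ_of_le (Finset.le_sup (f := Finsupp.degree) (mem_support_iff.2 hγ))⟩

theorem eq_zero_of_mem_degreeLT_zero {g : MvPolynomial σ R} (hg : g ∈ degreeLT σ R 0) : g = 0 := by
  ext γ
  by_contra h
  exact absurd (hg γ h) (Nat.not_lt_zero _)

theorem powMap_injective (hl : ∀ j, l j ∈ degreeLT σ R p) :
    Function.Injective (powMap p l) := by
  rw [injective_iff_map_eq_zero]
  intro g hg
  obtain ⟨n, hn⟩ := exists_mem_degreeLT g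
  induction n with
  | zero => exact eq_zero_of_mem_degreeLT_zero hn
  | succ n ih => exact ih (by simpa [hg] using powMap_sub_mem hl hn)

theorem powMap_surjective (hl : ∀ j, l j ∈ degreeLT σ R p) :
    Function.Surjective (powMap p l) := by
  intro g
  obtain ⟨n, hn⟩ := exists_mem_degreeLT g
  induction n generalizing g with
  | zero => exact ⟨0, by rw [eq_zero_of_mem_degreeLT_zero hn, map_zero]⟩
  | succ n ih =>
    obtain ⟨h, hh⟩ := ih _ (powMap_sub_mem hl hn)
    exact ⟨g - h, by rw [map_sub, hh]; ring⟩

/-- The polynomials without any monomial all of whose exponents are less than `p`. -/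
def nonReduced (σ R : Type*) [CommRing R] (p : ℕ) : Submodule R (MvPolynomial σ R) where
  carrier := {g | ∀ γ : σ →₀ ℕ, (∀ j, γ j < p) → coeff γ g = 0}
  zero_mem' := by simp
  add_mem' := by
    intro a b ha hb γ h
    rw [coeff_add, ha γ h, hb γ h, add_zero]
  smul_mem' := by
    intro c a ha γ h
    rw [coeff_smul, ha γ h, smul_zero]

theorem mul_powMonomial (hp : 0 < p) (j : σ) (γ : σ →₀ ℕ) :
    (X j ^ p - l j) * powMonomial p l γ = powMonomial p l (γ + Finsupp.single j p) := by
  classical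
  have h0 : ∀ i : σ, (X i ^ p - l i) ^ (0 / p) * X i ^ (0 % p) = 1 := by simp
  rw [powMonomial, powMonomial, ← Finsupp.mul_prod_erase' γ j _ h0,
    ← Finsupp.mul_prod_erase' (γ + Finsupp.single j p) j _ h0]
  have : (γ + Finsupp.single j p).erase j = γ.erase j := by
    rw [Finsupp.erase_add, Finsupp.erase_single, add_zero]
  rw [this, Finsupp.add_apply, Finsupp.single_eq_same, Nat.add_div_right _ hp, Nat.add_mod_right,
    pow_succ]
  ring

theorem powMap_mul_X_pow (hp : 0 < p) (j : σ) (h : MvPolynomial σ R) :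
    powMap p l (h * X j ^ p) = (X j ^ p - l j) * powMap p l h := by
  induction h using MvPolynomial.induction_on' with
  | monomial γ a =>
    have h1 (δ : σ →₀ ℕ) : monomial δ a = a • monomial δ (1 : R) := by simp [smul_monomial]
    rw [X_pow_eq_monomial, monomial_mul, mul_one, h1, h1, map_smul, map_smul, powMap_monomial,
      powMap_monomial, ← mul_powMonomial hp, mul_smul_comm, X_pow_eq_monomial]
  | add a b ha hb => rw [add_mul, map_add, ha, hb, map_add, mul_add]

theorem powMonomial_of_lt {γ : σ →₀ ℕ} (h : ∀ j, γ j < p) :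
    powMonomial p l γ = monomial γ 1 := by
  rw [monomial_eq, map_one, one_mul, powMonomial]
  refine Finsupp.prod_congr fun j _ => ?_
  rw [Nat.div_eq_of_lt (h j), Nat.mod_eq_of_lt (h j), pow_zero, one_mul]

/-- The ideal generated by the polynomials `X j ^ p - l j` contains no nonzero polynomial all of
whose exponents are less than `p`, provided that the `l j` have degree less than `p`. -/
theorem eq_zero_of_mem_span_of_reduced (hp : 0 < p) (hl : ∀ j, l j ∈ degreeLT σ R p)
    {g : MvPolynomial σ R} (hg : g ∈ Ideal.span (Set.range fun j => X j ^ p - l j))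
    (hred : ∀ γ, coeff γ g ≠ 0 → ∀ j, γ j < p) : g = 0 := by
  have hmem : g ∈ (nonReduced σ R p).map (powMap p l) := by
    rw [Ideal.span, ← Set.image_univ, Submodule.mem_span_image_iff_exists_fun] at hg
    obtain ⟨t, -, c, rfl⟩ := hg
    refine sum_mem fun j _ => ?_
    obtain ⟨h, hh⟩ := powMap_surjective hl (c j)
    refine ⟨h * X j.1 ^ p, fun γ hγ => ?_, ?_⟩
    · rw [X_pow_eq_monomial, coeff_mul_monomial', if_neg]
      intro hle
      have := hle j.1
      rw [Finsupp.single_eq_same] at this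
      exact absurd (hγ j.1) (not_lt.2 this)
    · rw [powMap_mul_X_pow hp, hh, smul_eq_mul, mul_comm]
  obtain ⟨k, hk, hkg⟩ := hmem
  have hfix : powMap p l g = g := by
    conv_lhs => rw [g.as_sum]
    conv_rhs => rw [g.as_sum]
    rw [map_sum]
    refine Finset.sum_congr rfl fun γ hγ => ?_
    have : monomial γ (coeff γ g) = coeff γ g • monomial γ (1 : R) := by simp [smul_monomial]
    rw [this, map_smul, powMap_monomial, powMonomial_of_lt (hred γ (mem_support_iff.1 hγ))]
  have hkg' : k = g := powMap_injective hl (hkg.trans hfix.symm)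
  subst hkg'
  ext γ
  by_contra h
  exact h (hk γ (hred γ h))

end PowerReduction

end MvPolynomial
namespace RestrictedLieAlgebra

section Universal

variable {p : ℕ} {F H : Type*} [Field F] [LieRing H] [LieAlgebra F H] [RestrictedLieAlgebra p F H]

theorem uemb_pow (x : H) : uemb p F H x ^ p = uemb p F H (pmap p F H x) := by
  simp only [uemb, LinearMap.comp_apply, AlgHom.toLinearMap_apply]
  rw [← map_pow]
  exact RingQuot.mkAlgHom_rel F ⟨x, rfl, rfl⟩

theorem uemb_lie (x y : H) :
    uemb p F H ⁅x, y⁆ = uemb p F H x * uemb p F H y - uemb p F H y * uemb p F H x := by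
  simp [uemb, LieRing.of_associative_ring_bracket]

/-- The restricted enveloping algebra is generated by the image of `H`. -/
theorem adjoin_range_uemb : Algebra.adjoin F (Set.range (uemb p F H)) = ⊤ := by
  let π : TensorAlgebra F H →ₐ[F] uEnv p F H :=
    (RingQuot.mkAlgHom F (uRel p F H)).comp (UniversalEnvelopingAlgebra.mkAlgHom F H)
  have hπ : Function.Surjective π :=
    (RingQuot.mkAlgHom_surjective F (uRel p F H)).comp (RingCon.mk'_surjective _)
  have h : Set.range (uemb p F H) = π '' Set.range (TensorAlgebra.ι F (M := H)) := by
    rw [← Set.range_comp]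
    rfl
  rw [h, ← AlgHom.map_adjoin, TensorAlgebra.adjoin_range_ι, Algebra.map_top]
  exact (AlgHom.range_eq_top π).2 hπ

variable {A : Type*} [Ring A] [Algebra F A]

/-- A Lie homomorphism to an associative algebra which respects the `p`-map extends to the
restricted enveloping algebra. -/
theorem exists_algHom_of_pmap (φ : H →ₗ⁅F⁆ A) (hφ : ∀ x, φ x ^ p = φ (pmap p F H x)) :
    ∃ Φ : uEnv p F H →ₐ[F] A, ∀ x, Φ (uemb p F H x) = φ x := by
  refine ⟨RingQuot.liftAlgHom F ⟨UniversalEnvelopingAlgebra.lift F φ, ?_⟩, fun x => ?_⟩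
  · rintro a b ⟨x, rfl, rfl⟩
    rw [map_pow, UniversalEnvelopingAlgebra.lift_ι_apply, UniversalEnvelopingAlgebra.lift_ι_apply,
      hφ]
  · simp [uemb]

/-- It suffices to check compatibility with the `p`-map on a basis. -/
theorem exists_algHom_of_basis [Fact p.Prime] {ι : Type*} (b : Module.Basis ι F H)
    (φ : H →ₗ⁅F⁆ A) (hφ : ∀ i, φ (b i) ^ p = φ (pmap p F H (b i))) :
    ∃ Φ : uEnv p F H →ₐ[F] A, ∀ x, Φ (uemb p F H x) = φ x := by
  refine exists_algHom_of_pmap φ fun x => ?_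
  have hp : p ≠ 0 := (Fact.out : p.Prime).ne_zero
  induction b.mem_span x using Submodule.span_induction with
  | mem x hx => obtain ⟨i, rfl⟩ := hx; exact hφ i
  | zero =>
    have h0 : pmap p F H 0 = 0 := by simpa [hp] using pOp_smul (p := p) (0 : F) (0 : H)
    rw [h0, map_zero, zero_pow hp]
  | add x y _ _ hx hy =>
    have h := congrArg (UniversalEnvelopingAlgebra.lift F φ) (pOp_add (p := p) (F := F) x y)
    simp only [map_sub, map_pow, map_add, UniversalEnvelopingAlgebra.lift_ι_apply] at h
    rw [hx, hy] at h
    rw [map_add]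
    exact (sub_left_injective (sub_left_injective h)).symm
  | smul a x _ hx => rw [pmap, pOp_smul, map_smul, map_smul, smul_pow, hx]

/-- If the restricted enveloping algebra is commutative, then `H` is nilpotent of class at most
two. -/
theorem lie_lie_eq_zero_of_commute (hcomm : ∀ a b : uEnv p F H, a * b = b * a) (x y z : H) :
    ⁅⁅x, y⁆, z⁆ = 0 := by
  obtain ⟨Φ, hΦ⟩ := exists_algHom_of_pmap (p := p) (LieAlgebra.ad F H) fun x => by
    ext y
    exact (ad_pOp x y).symm
  have h := congrArg Φ (hcomm (uemb p F H x) (uemb p F H y))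
  rw [map_mul, map_mul, hΦ, hΦ] at h
  have h' := LinearMap.congr_fun h z
  simp only [Module.End.mul_apply, LieAlgebra.ad_apply] at h'
  rw [lie_lie, h', sub_self]

end Universal

theorem _root_.Derivation.iterate_mul_of_sq {F P : Type*} [CommRing F] [CommRing P] [Algebra F P]
    (D : Derivation F P P) {x : P} (hx : D (D x) = 0) (g : P) (n : ℕ) :
    D^[n + 1] (x * g) = x * D^[n + 1] g + (n + 1 : ℕ) * (D x * D^[n] g) := by
  induction n with
  | zero => simp [Derivation.leibniz, mul_comm]
  | succ n ih =>
    rw [Function.iterate_succ_apply', ih, map_add, Derivation.leibniz, Derivation.leibniz,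
      Derivation.leibniz, hx, Derivation.map_natCast, Function.iterate_succ_apply' D (n + 1),
      Function.iterate_succ_apply' D n]
    simp only [smul_eq_mul]
    push_cast
    ring

/-- In characteristic `p`, a derivation of a polynomial ring whose square kills the variables has
vanishing `p`-th power. -/
theorem _root_.MvPolynomial.derivation_iterate_eq_zero {F σ : Type*} [CommRing F] {p : ℕ}
    [hp : Fact p.Prime] [CharP F p]
    (D : Derivation F (MvPolynomial σ F) (MvPolynomial σ F))
    (hD : ∀ i, D (D (MvPolynomial.X i)) = 0) (g : MvPolynomial σ F) : D^[p] g = 0 := by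
  obtain ⟨n, rfl⟩ : ∃ n, p = n + 1 := ⟨p - 1, by have := hp.out.pos; omega⟩
  have hz (m : ℕ) : D^[m] 0 = 0 := by
    induction m with
    | zero => rfl
    | succ m ih => rw [Function.iterate_succ_apply, map_zero, ih]
  induction g using MvPolynomial.induction_on with
  | C a => rw [Function.iterate_succ_apply, MvPolynomial.derivation_C, hz]
  | add f g hf hg => rw [iterate_map_add, hf, hg, add_zero]
  | mul_X g i hg =>
    rw [mul_comm, D.iterate_mul_of_sq (hD i), hg, CharP.cast_eq_zero, mul_zero, zero_mul, add_zero]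

theorem _root_.LinearIndependent.exists_basis_extending {F : Type*} {V : Type*} {κ : Type*}
    [Field F] [AddCommGroup V] [Module F V] {v : κ → V} (hv : LinearIndependent F v) :
    ∃ (s : Set V) (b : Module.Basis s F V) (g : κ → s), Function.Injective g ∧
      ∀ k, b (g k) = v k := by
  refine ⟨_, Module.Basis.extend hv.linearIndepOn_id,
    fun k => ⟨v k, Module.Basis.subset_extend hv.linearIndepOn_id ⟨k, rfl⟩⟩, ?_, ?_⟩
  · intro k l h
    exact hv.injective (Subtype.ext_iff.1 h)
  · simp

section ClassTwo

variable {F H : Type*} [Field F] [LieRing H] [LieAlgebra F H]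

/-- For a Lie algebra of class at most two the bracket is the antisymmetrization of a bilinear
map which factors through the quotient by the centre, has central values, and vanishes on the
diagonal of a basis. -/
theorem exists_bilinear_of_class_two (h2 : ∀ x y z : H, ⁅⁅x, y⁆, z⁆ = 0) :
    ∃ (s : Set H) (b : Module.Basis s F H) (c : H →ₗ[F] H →ₗ[F] H),
      (∀ x y, c x y - c y x = ⁅x, y⁆) ∧ (∀ x y w : H, ⁅c x y, w⁆ = 0) ∧
      (∀ z : H, (∀ w : H, ⁅z, w⁆ = 0) → ∀ x, c z x = 0 ∧ c x z = 0) ∧ ∀ i, c (b i) (b i) = 0 := by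
  classical
  let Z : Submodule F H := LinearMap.ker (LieAlgebra.ad F H : H →ₗ[F] Module.End F H)
  have hZ (z : H) : z ∈ Z ↔ ∀ w : H, ⁅z, w⁆ = 0 := by
    rw [LinearMap.mem_ker]
    exact ⟨fun h w => LinearMap.congr_fun h w, fun h => LinearMap.ext h⟩
  let bZ := Module.Basis.ofVectorSpace F Z
  obtain ⟨s, b, g, -, hg⟩ :=
    (bZ.linearIndependent.map' Z.subtype Z.ker_subtype).exists_basis_extending
  let _ : LinearOrder s := linearOrderOfSTO WellOrderingRel
  let c : H →ₗ[F] H →ₗ[F] H := b.constr F fun i => b.constr F fun j =>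
    if j < i then ⁅b i, b j⁆ else 0
  have hc (i j : s) : c (b i) (b j) = if j < i then ⁅b i, b j⁆ else 0 := by
    simp [c, Module.Basis.constr_basis]
  have hspan : ∀ z ∈ Z, z ∈ Submodule.span F (b '' {i | b i ∈ Z}) := by
    intro z hz
    have h1 : (⟨z, hz⟩ : Z) ∈ Submodule.span F (Set.range bZ) := bZ.mem_span _
    have h2 := Submodule.mem_map_of_mem (f := Z.subtype) h1
    rw [Submodule.map_span] at h2
    refine Submodule.span_mono ?_ h2
    rintro _ ⟨_, ⟨k, rfl⟩, rfl⟩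
    refine ⟨g k, ?_, hg k⟩
    show b (g k) ∈ Z
    rw [hg k]
    exact (bZ k).2
  refine ⟨s, b, c, fun x y => ?_, fun x y w => ?_, fun z hz x => ⟨?_, ?_⟩, fun i => ?_⟩
  · have : c - c.flip = (LieAlgebra.ad F H : H →ₗ[F] Module.End F H) := by
      refine b.ext fun i => b.ext fun j => ?_
      simp only [LinearMap.sub_apply, LinearMap.flip_apply, hc]
      rcases lt_trichotomy i j with h | h | h
      · simp [h, h.not_gt]
      · simp [h]
      · simp [h, h.not_gt]
    simpa using LinearMap.congr_fun (LinearMap.congr_fun this x) y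
  · suffices h : ∀ x y, c x y ∈ Z from (hZ _).1 (h x y) w
    intro x y
    induction b.mem_span x using Submodule.span_induction with
    | zero => simp
    | add x₁ x₂ _ _ h₁ h₂ => simpa using add_mem h₁ h₂
    | smul a x _ h => simpa using Z.smul_mem a h
    | mem x hx =>
      obtain ⟨i, rfl⟩ := hx
      induction b.mem_span y using Submodule.span_induction with
      | zero => simp
      | add x₁ x₂ _ _ h₁ h₂ => simpa using add_mem h₁ h₂
      | smul a x _ h => simpa using Z.smul_mem a h
      | mem y hy =>
        obtain ⟨j, rfl⟩ := hy
        rw [hc]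
        split_ifs
        · exact (hZ _).2 (h2 _ _)
        · exact zero_mem _
  · have : Submodule.span F (b '' {i | b i ∈ Z}) ≤ LinearMap.ker c := by
      rw [Submodule.span_le]
      rintro _ ⟨i, hi, rfl⟩
      refine b.ext fun j => ?_
      simp [hc, (hZ _).1 hi]
    rw [LinearMap.mem_ker.1 (this (hspan z ((hZ z).2 hz))), LinearMap.zero_apply]
  · have : Submodule.span F (b '' {i | b i ∈ Z}) ≤ LinearMap.ker c.flip := by
      rw [Submodule.span_le]
      rintro _ ⟨i, hi, rfl⟩
      refine b.ext fun j => ?_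
      have : ⁅b j, b i⁆ = 0 := by rw [← lie_skew, (hZ _).1 hi, neg_zero]
      simp [hc, this]
    rw [← LinearMap.flip_apply, LinearMap.mem_ker.1 (this (hspan z ((hZ z).2 hz))),
      LinearMap.zero_apply]
  · simp [hc]

end ClassTwo
section LinearForms

open MvPolynomial

variable {p : ℕ} {F H ι : Type*} [Field F] [LieRing H] [LieAlgebra F H]

/-- The linear map to the polynomial ring sending the basis vector `b i` to the variable `X i`. -/
noncomputable def linForm (b : Module.Basis ι F H) : H →ₗ[F] MvPolynomial ι F :=
  b.constr F fun i => (X i : MvPolynomial ι F)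

@[simp]
theorem linForm_basis (b : Module.Basis ι F H) (i : ι) : linForm b (b i) = X i :=
  b.constr_basis F _ i

theorem linForm_mem_degreeLT (b : Module.Basis ι F H) (hp : 2 ≤ p) (x : H) :
    linForm b x ∈ degreeLT ι F p := by
  suffices h : ⊤ ≤ (degreeLT ι F p).comap (linForm b) from h trivial
  rw [← b.span_eq, Submodule.span_le]
  rintro _ ⟨i, rfl⟩
  have : X i ∈ degreeLT ι F p := monomial_mem_degreeLT (by rw [Finsupp.degree_single]; omega)
  simpa using this

theorem linForm_injective (b : Module.Basis ι F H) : Function.Injective (linForm b) := by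
  classical
  intro x y h
  have key (i : ι) : (lcoeff F (Finsupp.single i 1)).comp (linForm b) = b.coord i := by
    refine b.ext fun j => ?_
    simp [coeff_X, Finsupp.single_apply, Finsupp.single_left_inj]
  refine b.ext_elem fun i => ?_
  have := congrArg (lcoeff F (Finsupp.single i 1)) h
  rwa [← LinearMap.comp_apply, ← LinearMap.comp_apply, key] at this

variable [RestrictedLieAlgebra p F H]

/-- The ideal generated by the polynomials `X i ^ p - (b i)^[p]`. -/
noncomputable def powIdeal (p : ℕ) [RestrictedLieAlgebra p F H] (b : Module.Basis ι F H) :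
    Ideal (MvPolynomial ι F) :=
  Ideal.span (Set.range fun i => X i ^ p - linForm b (pmap p F H (b i)))

theorem mk_X_pow (b : Module.Basis ι F H) (i : ι) :
    Ideal.Quotient.mk (powIdeal p b) (X i ^ p)
      = Ideal.Quotient.mk (powIdeal p b) (linForm b (pmap p F H (b i))) :=
  Ideal.Quotient.eq.2 (Ideal.subset_span ⟨i, rfl⟩)

theorem eq_zero_of_mem_powIdeal (hp : 2 ≤ p) (b : Module.Basis ι F H) {g : MvPolynomial ι F}
    (hg : g ∈ powIdeal p b) (hred : ∀ γ, coeff γ g ≠ 0 → ∀ i, γ i < p) : g = 0 :=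
  eq_zero_of_mem_span_of_reduced (by omega) (fun _ => linForm_mem_degreeLT b hp _) hg hred

theorem eq_zero_of_linForm_mem_powIdeal (hp : 2 ≤ p) (b : Module.Basis ι F H) {x : H}
    (hx : linForm b x ∈ powIdeal p b) : x = 0 := by
  refine linForm_injective b ?_
  rw [map_zero]
  exact eq_zero_of_mem_powIdeal hp b hx fun γ hγ i =>
    (Finsupp.le_degree i γ).trans_lt (linForm_mem_degreeLT b hp x γ hγ)

end LinearForms

section Embedding

open MvPolynomial

variable {p : ℕ} {F H : Type*} [Field F] [Fact p.Prime] [CharP F p]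
  [LieRing H] [LieAlgebra F H] [RestrictedLieAlgebra p F H]

/-- A restricted Lie algebra of class at most two embeds into its restricted enveloping algebra. -/
theorem uemb_injective_of_class_two (h2 : ∀ x y z : H, ⁅⁅x, y⁆, z⁆ = 0) :
    Function.Injective (uemb p F H) := by
  have hp : 2 ≤ p := (Fact.out : p.Prime).two_le
  obtain ⟨s, b, c, hanti, hcentral, hker, hdiag⟩ := exists_bilinear_of_class_two (F := F) h2
  let P := MvPolynomial s F
  let I : Submodule F P := (powIdeal p b).restrictScalars F
  have hpc (x w : H) : ⁅pmap p F H x, w⁆ = 0 := by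
    obtain ⟨n, rfl⟩ : ∃ n, p = n + 2 := ⟨p - 2, by omega⟩
    rw [pmap, ad_pOp, pow_add, Module.End.mul_apply, pow_two, Module.End.mul_apply,
      LieAlgebra.ad_apply, LieAlgebra.ad_apply, ← lie_skew, h2, neg_zero, map_zero]
  let D : H →ₗ[F] Derivation F P P :=
    (mkDerivationEquiv F).toLinearMap ∘ₗ LinearMap.pi fun i => linForm b ∘ₗ c.flip (b i)
  have hDX (x : H) (i : s) : D x (X i) = linForm b (c x (b i)) :=
    mkDerivation_X _ _ i
  have hDlin (x y : H) : D x (linForm b y) = linForm b (c x y) := by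
    have : (D x).toLinearMap ∘ₗ linForm b = linForm b ∘ₗ c x :=
      b.ext fun i => by
        show D x (linForm b (b i)) = linForm b (c x (b i))
        rw [linForm_basis, hDX]
    exact LinearMap.congr_fun this y
  have hDcomm (x y : H) (g : P) : D x (D y g) = D y (D x g) := by
    have : ⁅D x, D y⁆ = 0 := by
      refine derivation_ext fun i => ?_
      simp [Derivation.commutator_apply, hDX, hDlin, (hker _ (hcentral _ _) _).2]
    have := DFunLike.congr_fun this g
    rwa [Derivation.commutator_apply, Derivation.zero_apply, sub_eq_zero] at this
  have hDc (z : H) (hz : ∀ w : H, ⁅z, w⁆ = 0) (g : P) : D z g = 0 := by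
    have : D z = 0 := derivation_ext fun i => by simp [hDX, (hker z hz _).1]
    rw [this, Derivation.zero_apply]
  let ρ : H →ₗ[F] P →ₗ[F] P := LinearMap.mul F P ∘ₗ linForm b +
    { toFun := fun x => (D x).toLinearMap, map_add' := by intros; ext; simp
      map_smul' := by intros; ext; simp }
  have hρ (x : H) (g : P) : ρ x g = linForm b x * g + D x g := rfl
  have hρI (x : H) : ρ x ∈ Submodule.compatibleMaps I I := by
    intro g hg
    show ρ x g ∈ powIdeal p b
    rw [hρ]
    refine add_mem (Ideal.mul_mem_left _ _ hg) ?_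
    refine Submodule.span_induction (p := fun g _ => D x g ∈ powIdeal p b) ?_ ?_ ?_ ?_ hg
    · rintro _ ⟨i, rfl⟩
      simp [Derivation.leibniz_pow, hDlin, (hker _ (hpc (b i)) x).2, ← Nat.cast_smul_eq_nsmul P]
    · simp
    · intro f g _ _ hf hg
      rw [map_add]
      exact add_mem hf hg
    · intro a f hf hDf
      rw [smul_eq_mul, Derivation.leibniz]
      exact add_mem (Ideal.mul_mem_left _ _ hDf) (Ideal.mul_mem_right _ _ hf)
  let ρI : H →ₗ[F] Module.End F (P ⧸ I) :=
    Submodule.mapQLinear I I ∘ₗ ρ.codRestrict _ hρI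
  have hρmk (x : H) (g : P) : ρI x (I.mkQ g) = I.mkQ (ρ x g) := rfl
  have hρpow (x : H) (g : P) (n : ℕ) : (ρI x ^ n) (I.mkQ g) = I.mkQ ((ρ x ^ n) g) := by
    induction n with
    | zero => rfl
    | succ n ih => rw [pow_succ', pow_succ', Module.End.mul_apply, Module.End.mul_apply, ih, hρmk]
  have hρp (i : s) (g : P) : (ρ (b i) ^ p) g = X i ^ p * g := by
    let T : Module.End F P := (D (b i)).toLinearMap
    have hDi : D (b i) (X i) = 0 := by rw [hDX, hdiag, map_zero]
    have hsum : ρ (b i) = LinearMap.mulLeft F (X i) + T := by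
      refine LinearMap.ext fun g => ?_
      rw [hρ, linForm_basis]
      rfl
    have hcomm : Commute (LinearMap.mulLeft F (X i : P)) T := by
      refine LinearMap.ext fun g => ?_
      show X i * D (b i) g = D (b i) (X i * g)
      rw [Derivation.leibniz, hDi, smul_zero, add_zero, smul_eq_mul]
    have : CharP (Module.End F P) p := charP_of_injective_algebraMap
      (FaithfulSMul.algebraMap_injective F (Module.End F P)) p
    have hT : (T ^ p) g = 0 := by
      rw [Module.End.pow_apply]
      refine derivation_iterate_eq_zero (D (b i)) (fun j => ?_) g
      rw [hDX, hDlin, (hker _ (hcentral _ _) _).2, map_zero]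
    rw [hsum, add_pow_char_of_commute _ hcomm, LinearMap.add_apply, hT, add_zero,
      LinearMap.pow_mulLeft, LinearMap.mulLeft_apply]
  let φ : H →ₗ⁅F⁆ Module.End F (P ⧸ I) :=
    { ρI with
      map_lie' := by
        intro x y
        refine Submodule.linearMap_qext _ (LinearMap.ext fun g => ?_)
        show ρI ⁅x, y⁆ (I.mkQ g) = ⁅ρI x, ρI y⁆ (I.mkQ g)
        rw [LieRing.of_associative_ring_bracket, LinearMap.sub_apply, Module.End.mul_apply,
          Module.End.mul_apply, hρmk, hρmk, hρmk, hρmk, hρmk, ← map_sub]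
        congr 1
        rw [hρ, hDc _ (h2 x y), ← hanti x y]
        simp only [hρ, map_add, Derivation.leibniz, hDlin, map_sub, smul_eq_mul, hDcomm x y]
        ring }
  obtain ⟨Φ, hΦ⟩ := exists_algHom_of_basis (p := p) b φ fun i => by
    refine Submodule.linearMap_qext _ (LinearMap.ext fun g => ?_)
    show (ρI (b i) ^ p) (I.mkQ g) = ρI (pmap p F H (b i)) (I.mkQ g)
    rw [hρpow, hρmk, hρ, hDc _ (hpc (b i)), add_zero, hρp]
    refine (Submodule.Quotient.eq I).2 ?_
    rw [← sub_mul]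
    exact Ideal.mul_mem_right _ _ (Ideal.subset_span ⟨i, rfl⟩)
  rw [injective_iff_map_eq_zero]
  intro x hx
  have h := hΦ x
  rw [hx, map_zero] at h
  have h1 : I.mkQ (ρ x 1) = 0 := (LinearMap.congr_fun h (I.mkQ 1)).symm
  rw [hρ, mul_one, Derivation.map_one_eq_zero, add_zero] at h1
  exact eq_zero_of_linForm_mem_powIdeal hp b ((Submodule.Quotient.mk_eq_zero I).1 h1)

end Embedding
section TruncatedMonomials

variable {F A κ : Type*} [Field F] [CommRing A] [Algebra F A] [Fintype κ]

/-- The product of the powers `c k ^ α k`, with exponents less than `p`. -/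
def truncMonomial (p : ℕ) (c : κ → A) (α : κ → Fin p) : A := ∏ k, c k ^ (α k : ℕ)

open MvPolynomial in
/-- If the span of `c` contains all `c k ^ p`, then the monomials in `c` with exponents less than
`p` span the algebra generated by `c`. -/
theorem mem_span_truncMonomial {p : ℕ} (hp : 2 ≤ p) {c : κ → A}
    (hc : ∀ k, c k ^ p ∈ Submodule.span F (Set.range c)) {a : A}
    (ha : a ∈ Algebra.adjoin F (Set.range c)) :
    a ∈ Submodule.span F (Set.range (truncMonomial p c)) := by
  set T := Submodule.span F (Set.range (truncMonomial p c)) with hT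
  have hmon (n : ℕ) : ∀ γ : κ →₀ ℕ, γ.degree = n → aeval c (monomial γ (1 : F)) ∈ T := by
    induction n using Nat.strong_induction_on with
    | _ n ih =>
    intro γ hγ
    by_cases h : ∀ k, γ k < p
    · refine Submodule.subset_span ⟨fun k => ⟨γ k, h k⟩, ?_⟩
      rw [aeval_monomial, map_one, one_mul, Finsupp.prod_fintype _ _ fun _ => pow_zero _]
      rfl
    · push Not at h
      obtain ⟨k, hk⟩ := h
      obtain ⟨δ, rfl⟩ : ∃ δ, γ = δ + Finsupp.single k p :=
        ⟨γ - Finsupp.single k p, (tsub_add_cancel_of_le (Finsupp.single_le_iff.2 hk)).symm⟩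
      rw [map_add, Finsupp.degree_single] at hγ
      have hprod (δ' : κ →₀ ℕ) : aeval c (monomial (δ + δ') (1 : F))
          = aeval c (monomial δ (1 : F)) * aeval c (monomial δ' (1 : F)) := by
        rw [← map_mul, monomial_mul, one_mul]
      have hX : aeval c (monomial (Finsupp.single k p) (1 : F)) = c k ^ p := by
        rw [aeval_monomial, map_one, one_mul]
        exact Finsupp.prod_single_index (pow_zero _)
      rw [hprod, hX]
      have hck := hc k
      generalize c k ^ p = z at hck
      induction hck using Submodule.span_induction with
      | zero => simp
      | add x y _ _ hx hy => rw [mul_add]; exact add_mem hx hy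
      | smul r x _ hx => rw [mul_smul_comm]; exact T.smul_mem r hx
      | mem x hx =>
        obtain ⟨l, rfl⟩ := hx
        have := ih (δ.degree + 1) (by omega) (δ + Finsupp.single l 1) (by simp)
        rwa [hprod, show monomial (Finsupp.single l 1) (1 : F) = X l from rfl, aeval_X] at this
  rw [Algebra.adjoin_range_eq_range_aeval] at ha
  obtain ⟨g, rfl⟩ := ha
  change aeval c g ∈ T
  rw [g.as_sum, map_sum]
  refine sum_mem fun γ _ => ?_
  have : monomial γ (coeff γ g) = coeff γ g • monomial γ (1 : F) := by simp [smul_monomial]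
  rw [this, map_smul]
  exact T.smul_mem _ (hmon _ γ rfl)

end TruncatedMonomials

section Abelian

open MvPolynomial

open scoped IsMulCommutative in
/-- The restricted enveloping algebra of an abelian restricted Lie algebra is commutative. -/
theorem exists_commRing_algEquiv.{u, v} (p : ℕ) (F : Type u) (L : Type v) [Field F]
    [LieRing L] [LieAlgebra F L] [RestrictedLieAlgebra p F L] [IsLieAbelian L] :
    ∃ (B : Type (max u v)) (_ : CommRing B) (_ : Algebra F B),
      Nonempty (uEnv p F L ≃ₐ[F] B) := by
  have hcomm : ∀ a ∈ Set.range (uemb p F L), ∀ b ∈ Set.range (uemb p F L), a * b = b * a := by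
    rintro _ ⟨x, rfl⟩ _ ⟨y, rfl⟩
    rw [← sub_eq_zero, ← uemb_lie, trivial_lie_zero, map_zero]
  have := Algebra.isMulCommutative_adjoin F hcomm
  exact ⟨Algebra.adjoin F (Set.range (uemb p F L)), inferInstance, inferInstance,
    ⟨Subalgebra.topEquiv.symm.trans (Subalgebra.equivOfEq _ _ adjoin_range_uemb.symm)⟩⟩

variable {p : ℕ} {F L A : Type*} [Field F] [LieRing L] [LieAlgebra F L]
  [RestrictedLieAlgebra p F L] [CommRing A] [Algebra F A]

theorem map_uemb_iterate (e : uEnv p F L ≃ₐ[F] A) (i : ℕ) (x : L) :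
    e (uemb p F L ((pmap p F L)^[i] x)) = e (uemb p F L x) ^ p ^ i := by
  induction i generalizing x with
  | zero => simp
  | succ i ih => rw [Function.iterate_succ_apply, ih, ← uemb_pow, map_pow, ← pow_mul, pow_succ']

variable [Fact p.Prime]

theorem linearIndependent_truncMonomial [IsLieAbelian L] (e : uEnv p F L ≃ₐ[F] A) {κ : Type*}
    [Fintype κ] {c : κ → L} (hc : LinearIndependent F c) :
    LinearIndependent F (truncMonomial p fun k => e (uemb p F L (c k))) := by
  classical
  have hp : 2 ≤ p := (Fact.out : p.Prime).two_le
  obtain ⟨s, b, g, hg, hbg⟩ := hc.exists_basis_extending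
  let I := powIdeal p b
  let φ : L →ₗ⁅F⁆ MvPolynomial s F ⧸ I :=
    { (Ideal.Quotient.mkₐ F I).toLinearMap ∘ₗ linForm b with
      map_lie' := by
        intro x y
        rw [LieRing.of_associative_ring_bracket, mul_comm, sub_self, trivial_lie_zero]
        exact map_zero ((Ideal.Quotient.mkₐ F I).toLinearMap ∘ₗ linForm b) }
  have hφ (x : L) : φ x = Ideal.Quotient.mk I (linForm b x) := rfl
  obtain ⟨Φ, hΦ⟩ := exists_algHom_of_basis (p := p) b φ fun i => by
    rw [hφ, hφ, linForm_basis, ← map_pow, mk_X_pow]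
  let E (α : κ → Fin p) : s →₀ ℕ :=
    Finsupp.embDomain ⟨g, hg⟩ (Finsupp.equivFunOnFinite.symm fun k => (α k : ℕ))
  have hE (α : κ → Fin p) (k : κ) : E α (g k) = α k :=
    Finsupp.embDomain_apply_self ⟨g, hg⟩ _ k
  have hElt (α : κ → Fin p) (i : s) : E α i < p := by
    by_cases h : i ∈ Set.range g
    · obtain ⟨k, rfl⟩ := h
      rw [hE]
      exact (α k).2
    · have : E α i = 0 := Finsupp.embDomain_of_notMem_range ⟨g, hg⟩ _ i h
      omega
  have hEinj (α β : κ → Fin p) (h : E α = E β) : α = β := by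
    funext k
    rw [Fin.ext_iff, ← hE, ← hE, h]
  have hΦmon (α : κ → Fin p) : Φ (e.symm (truncMonomial p (fun k => e (uemb p F L (c k))) α))
      = Ideal.Quotient.mk I (monomial (E α) 1) := by
    have : ((Φ : uEnv p F L →ₐ[F] MvPolynomial s F ⧸ I).comp (e.symm : A →ₐ[F] uEnv p F L))
        (truncMonomial p (fun k => e (uemb p F L (c k))) α)
        = Ideal.Quotient.mk I (monomial (E α) 1) := by
      rw [monomial_eq, map_one, one_mul, Finsupp.prod_embDomain,
        Finsupp.prod_fintype _ _ fun _ => pow_zero _, truncMonomial, map_prod, map_prod]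
      refine Finset.prod_congr rfl fun k _ => ?_
      rw [map_pow, map_pow]
      simp [hΦ, hφ, ← hbg]
    exact this
  rw [Fintype.linearIndependent_iff]
  intro a ha β
  have h0 := congrArg (fun x => Φ (e.symm x)) ha
  simp only [map_sum, map_smul, map_zero, hΦmon] at h0
  have hmem : ∑ α, a α • monomial (E α) (1 : F) ∈ I := by
    rw [← Ideal.Quotient.eq_zero_iff_mem, ← h0, map_sum]
    rfl
  have hcoeff (γ : s →₀ ℕ) : coeff γ (∑ α, a α • monomial (E α) (1 : F))
      = ∑ α, if E α = γ then a α else 0 := by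
    simp [coeff_sum, coeff_monomial]
  have hz := eq_zero_of_mem_powIdeal hp b hmem fun γ hγ => by
    rw [hcoeff] at hγ
    obtain ⟨α, -, hα⟩ := Finset.exists_ne_zero_of_sum_ne_zero hγ
    obtain rfl : E α = γ := by
      by_contra h
      exact hα (if_neg h)
    exact hElt α
  have := hcoeff (E β)
  rw [hz, coeff_zero, Finset.sum_eq_single β (fun α _ hα => if_neg fun h => hα (hEinj _ _ h))
    (by simp), if_pos rfl] at this
  exact this.symm

variable [CharP F p]

/-- The `p ^ i`-th powers in a commutative restricted enveloping algebra are spanned by the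
truncated monomials in a basis of the span of the `p ^ i`-th powers in the Lie algebra. -/
theorem exists_span_pow_eq [FiniteDimensional F L] (e : uEnv p F L ≃ₐ[F] A) (i : ℕ) :
    ∃ c : Fin (Module.finrank F (Submodule.span F (Set.range (pmap p F L)^[i]))) → L,
      LinearIndependent F c ∧ Submodule.span F (Set.range fun a : A => a ^ p ^ i)
        = Submodule.span F (Set.range (truncMonomial p fun k => e (uemb p F L (c k)))) := by
  have hp : 2 ≤ p := (Fact.out : p.Prime).two_le
  obtain ⟨c, hcmem, hcspan, hcind⟩ :=
    Submodule.exists_fun_fin_finrank_span_eq F (Set.range (pmap p F L)^[i])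
  refine ⟨c, hcind, ?_⟩
  choose x hx using hcmem
  have : Nontrivial A := by
    have : Nontrivial (uEnv p F L) := (aug p F L).toRingHom.domain_nontrivial
    exact e.symm.toEquiv.nontrivial
  have : CharP A p := charP_of_injective_algebraMap (algebraMap F A).injective p
  let j : L →ₗ[F] A := e.toLinearMap ∘ₗ uemb p F L
  have hj (y : L) :
      j ((pmap p F L)^[i] y) ∈ Submodule.span F (Set.range fun k => e (uemb p F L (c k))) := by
    have h1 : (pmap p F L)^[i] y ∈ Submodule.span F (Set.range c) := by
      rw [hcspan]
      exact Submodule.subset_span ⟨y, rfl⟩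
    have h2 := Submodule.mem_map_of_mem (f := j) h1
    rwa [Submodule.map_span, ← Set.range_comp] at h2
  have hgen : Algebra.adjoin F (Set.range fun y => e (uemb p F L y)) = ⊤ := by
    have := congrArg (Subalgebra.map (e : uEnv p F L →ₐ[F] A))
      (adjoin_range_uemb (p := p) (F := F) (H := L))
    rw [AlgHom.map_adjoin, Algebra.map_top, (AlgHom.range_eq_top _).2 e.surjective,
      ← Set.range_comp] at this
    exact this
  apply le_antisymm
  · rw [Submodule.span_le]
    rintro _ ⟨a, rfl⟩
    refine mem_span_truncMonomial hp (fun k => ?_) ?_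
    · have h := hj (pmap p F L (x k))
      rw [← Function.iterate_succ_apply, Function.iterate_succ_apply', hx] at h
      rw [← map_pow, uemb_pow]
      exact h
    · have ha : a ∈ Algebra.adjoin F (Set.range fun y => e (uemb p F L y)) := by
        rw [hgen]; trivial
      induction ha using Algebra.adjoin_induction with
      | mem a ha =>
        obtain ⟨y, rfl⟩ := ha
        have h := hj y
        change e (uemb p F L ((pmap p F L)^[i] y)) ∈ _ at h
        rw [map_uemb_iterate] at h
        exact Algebra.span_le_adjoin F _ h
      | algebraMap r => exact pow_mem (Subalgebra.algebraMap_mem _ r) _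
      | add a b _ _ ha hb =>
        change (a + b) ^ p ^ i ∈ _
        rw [add_pow_char_pow]
        exact add_mem ha hb
      | mul a b _ _ ha hb =>
        change (a * b) ^ p ^ i ∈ _
        rw [mul_pow]
        exact mul_mem ha hb
  · rw [Submodule.span_le]
    rintro _ ⟨α, rfl⟩
    refine Submodule.subset_span ⟨truncMonomial p (fun k => e (uemb p F L (x k))) α, ?_⟩
    simp only [truncMonomial]
    rw [← Finset.prod_pow]
    refine Finset.prod_congr rfl fun k _ => ?_
    rw [← hx, map_uemb_iterate, pow_right_comm]

theorem finrank_span_pow [FiniteDimensional F L] [IsLieAbelian L] (e : uEnv p F L ≃ₐ[F] A)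
    (i : ℕ) : Module.finrank F (Submodule.span F (Set.range fun a : A => a ^ p ^ i))
      = p ^ Module.finrank F (Submodule.span F (Set.range (pmap p F L)^[i])) := by
  obtain ⟨c, hc, h⟩ := exists_span_pow_eq e i
  rw [h, finrank_span_eq_card (linearIndependent_truncMonomial e hc)]
  simp

theorem finiteDimensional_of_algEquiv [FiniteDimensional F L] (e : uEnv p F L ≃ₐ[F] A) :
    FiniteDimensional F A := by
  obtain ⟨c, -, h⟩ := exists_span_pow_eq e 0
  have htop : Submodule.span F (Set.range fun a : A => a ^ p ^ 0) = ⊤ :=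
    Submodule.eq_top_iff'.2 fun a => Submodule.subset_span ⟨a, by simp⟩
  rw [h] at htop
  exact Module.finite_def.2 (htop ▸ Submodule.fg_span (Set.finite_range _))

theorem pmap_add [IsLieAbelian L] (x y : L) :
    pmap p F L (x + y) = pmap p F L x + pmap p F L y := by
  apply uemb_injective_of_class_two (p := p) (F := F) (H := L) fun x y z => by
    rw [trivial_lie_zero]
  have : Nontrivial (uEnv p F L) := (aug p F L).toRingHom.domain_nontrivial
  have : CharP (uEnv p F L) p := charP_of_injective_algebraMap (algebraMap F _).injective p
  have hxy : Commute (uemb p F L x) (uemb p F L y) := by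
    rw [commute_iff_eq, ← sub_eq_zero, ← uemb_lie, trivial_lie_zero, map_zero]
  rw [map_add, ← uemb_pow, ← uemb_pow, ← uemb_pow, map_add, add_pow_char_of_commute _ hxy]

end Abelian

end RestrictedLieAlgebra

section Semilinear

variable {F V W : Type*} [Field F] [AddCommGroup V] [Module F V] [AddCommGroup W] [Module F W]

variable (F V) in
theorem finrank_span_range_id :
    Module.finrank F (Submodule.span F (Set.range (id : V → V))) = Module.finrank F V := by
  rw [Set.range_id, Submodule.span_univ, finrank_top]

/-- An injective linear map from a subspace extends to an isomorphism of spaces of the same finite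
dimension. -/
theorem LinearMap.exists_linearEquiv_extending [FiniteDimensional F V] [FiniteDimensional F W]
    (h : Module.finrank F V = Module.finrank F W) {P : Submodule F V} {φ : P →ₗ[F] W}
    (hφ : Function.Injective φ) : ∃ e : V ≃ₗ[F] W, ∀ x : P, e x = φ x := by
  obtain ⟨C, hC⟩ := P.exists_isCompl
  obtain ⟨D, hD⟩ := φ.range.exists_isCompl
  have h1 := Submodule.finrank_add_eq_of_isCompl hC
  have h2 := Submodule.finrank_add_eq_of_isCompl hD
  rw [LinearMap.finrank_range_of_inj hφ] at h2
  let ψ : C ≃ₗ[F] D := LinearEquiv.ofFinrankEq C D (by omega)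
  refine ⟨(Submodule.prodEquivOfIsCompl P C hC).symm ≪≫ₗ
    ((LinearEquiv.ofInjective φ hφ).prodCongr ψ) ≪≫ₗ Submodule.prodEquivOfIsCompl _ D hD,
    fun x => ?_⟩
  simp

variable {σ : F →+* F} [RingHomSurjective σ]

theorem LinearMap.finrank_range_add_finrank_ker_semilinear [FiniteDimensional F V]
    (f : V →ₛₗ[σ] V) :
    Module.finrank F (LinearMap.range f) + Module.finrank F (LinearMap.ker f)
      = Module.finrank F V := by
  obtain ⟨C, hC⟩ := (LinearMap.ker f).exists_isCompl
  rw [← Submodule.finrank_add_eq_of_isCompl hC, add_comm]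
  congr 1
  let j : C →+ LinearMap.range f := (f.rangeRestrict.comp C.subtype).toAddMonoidHom
  have hj (x : C) : (j x : V) = f x := rfl
  have hbij : Function.Bijective j := by
    constructor
    · rw [injective_iff_map_eq_zero]
      intro x hx
      have hx' : (x : V) ∈ LinearMap.ker f := by
        rw [LinearMap.mem_ker, ← hj, hx, Submodule.coe_zero]
      exact Subtype.ext (Submodule.disjoint_def.1 hC.disjoint _ hx' x.2)
    · rintro ⟨_, v, rfl⟩
      obtain ⟨k, hk, c, hc, rfl⟩ : ∃ k ∈ LinearMap.ker f, ∃ c ∈ C, k + c = v :=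
        Submodule.mem_sup.1 (hC.sup_eq_top ▸ Submodule.mem_top)
      refine ⟨⟨c, hc⟩, Subtype.ext ?_⟩
      change f c = f (k + c)
      rw [map_add, LinearMap.mem_ker.1 hk, zero_add]
  have := rank_eq_of_equiv_equiv σ (AddEquiv.ofBijective j hbij)
    ⟨σ.injective, RingHomSurjective.is_surjective⟩ fun r x => Subtype.ext (by
      simp [hj])
  rw [Module.finrank, Module.finrank, this]

/-- The restriction of a semilinear endomorphism to its range. -/
def LinearMap.restrictRange (f : V →ₛₗ[σ] V) : LinearMap.range f →ₛₗ[σ] LinearMap.range f :=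
  f.rangeRestrict.comp (LinearMap.range f).subtype

theorem LinearMap.coe_restrictRange_iterate (f : V →ₛₗ[σ] V) (i : ℕ) (x : LinearMap.range f) :
    ((f.restrictRange^[i] x : LinearMap.range f) : V) = f^[i] x := by
  induction i generalizing x with
  | zero => rfl
  | succ i ih => rw [Function.iterate_succ_apply, ih, Function.iterate_succ_apply]; rfl

theorem LinearMap.finrank_span_restrictRange_iterate (f : V →ₛₗ[σ] V) (i : ℕ) :
    Module.finrank F (Submodule.span F (Set.range f.restrictRange^[i]))
      = Module.finrank F (Submodule.span F (Set.range f^[i + 1])) := by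
  have h : Set.range ((LinearMap.range f).subtype ∘ f.restrictRange^[i])
      = Set.range f^[i + 1] := by
    ext y
    constructor
    · rintro ⟨⟨_, x, rfl⟩, rfl⟩
      exact ⟨x, (f.coe_restrictRange_iterate i ⟨f x, x, rfl⟩).symm⟩
    · rintro ⟨x, rfl⟩
      exact ⟨⟨f x, x, rfl⟩, f.coe_restrictRange_iterate i ⟨f x, x, rfl⟩⟩
  rw [← Submodule.finrank_map_subtype_eq, Submodule.map_span, ← Set.range_comp, h]

/-- An isomorphism between the ranges of two semilinear endomorphisms, compatible with these
endomorphisms, extends to an isomorphism of the whole spaces. -/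
theorem LinearMap.exists_linearEquiv_of_range [FiniteDimensional F V] [FiniteDimensional F W]
    (f : V →ₛₗ[σ] V) (g : W →ₛₗ[σ] W) (h : Module.finrank F V = Module.finrank F W)
    (e' : LinearMap.range f ≃ₗ[F] LinearMap.range g)
    (he' : ∀ x, e' (f.restrictRange x) = g.restrictRange (e' x)) :
    ∃ e : V ≃ₗ[F] W, ∀ x, e (f x) = g (e x) := by
  have hg (x : LinearMap.range f) : g (e' x) = e' ⟨f x, x, rfl⟩ :=
    (congrArg Subtype.val (he' x)).symm
  have hker : Module.finrank F (LinearMap.ker f) = Module.finrank F (LinearMap.ker g) := by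
    have h1 := f.finrank_range_add_finrank_ker_semilinear
    have h2 := g.finrank_range_add_finrank_ker_semilinear
    have h3 := e'.finrank_eq
    omega
  let P := (LinearMap.range f).comap (LinearMap.ker f).subtype
  let φ : P →ₗ[F] LinearMap.ker g :=
    LinearMap.codRestrict _ ((LinearMap.range g).subtype ∘ₗ e'.toLinearMap ∘ₗ
      LinearMap.codRestrict (LinearMap.range f) ((LinearMap.ker f).subtype ∘ₗ P.subtype)
        fun x => x.2) fun x => by
      refine (hg _).trans ?_
      have : (⟨f (x : LinearMap.ker f), x, rfl⟩ : LinearMap.range f) = 0 := Subtype.ext x.1.2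
      exact congrArg Subtype.val (this ▸ map_zero e')
  have hφ (x : P) : (φ x : W) = e' ⟨x, x.2⟩ := rfl
  have hφinj : Function.Injective φ := fun x y hxy => by
    have := congrArg Subtype.val hxy
    rw [hφ, hφ, Subtype.coe_inj, e'.injective.eq_iff] at this
    exact Subtype.ext (Subtype.ext (congrArg (fun z : LinearMap.range f => (z : V)) this))
  obtain ⟨k, hk⟩ := LinearMap.exists_linearEquiv_extending hker hφinj
  let q₁ : V →ₗ.[F] W := ⟨LinearMap.range f, (LinearMap.range g).subtype ∘ₗ e'.toLinearMap⟩
  let q₂ : V →ₗ.[F] W := ⟨LinearMap.ker f, (LinearMap.ker g).subtype ∘ₗ k.toLinearMap⟩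
  have hq (x : q₁.domain) (y : q₂.domain) (hxy : (x : V) = y) : q₁ x = q₂ y := by
    obtain ⟨x, hx⟩ := x
    obtain ⟨y, hy⟩ := y
    obtain rfl : x = y := hxy
    exact (congrArg Subtype.val (hk ⟨⟨x, hy⟩, hx⟩)).symm
  let q := q₁.sup q₂ hq
  let t : V →ₛₗ[σ] W :=
    ((LinearMap.range g).subtype.comp e'.toLinearMap).comp f.rangeRestrict
  have ht (x : V) : t x = e' ⟨f x, x, rfl⟩ := rfl
  have hqt (z : q.domain) : g (q z) = t z := by
    obtain ⟨x, hx, y, hy, hxy⟩ := Submodule.mem_sup.1 z.2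
    rw [LinearPMap.sup_apply hq ⟨x, hx⟩ ⟨y, hy⟩ z hxy, ← hxy, map_add, map_add]
    congr 1
    · exact hg ⟨x, hx⟩
    · refine (k ⟨y, hy⟩).2.trans ?_
      have : f.rangeRestrict y = 0 := Subtype.ext hy
      change 0 = (e' (f.rangeRestrict y) : W)
      rw [this, map_zero, Submodule.coe_zero]
  obtain ⟨C, hC⟩ := q.domain.exists_isCompl
  let b := Module.Basis.ofVectorSpace F C
  choose w hw using fun i => (e' ⟨f (b i), b i, rfl⟩).2
  let r : C →ₗ[F] W := b.constr F w
  have hr : g.comp r = t.comp C.subtype := b.ext fun i => by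
    simp only [LinearMap.comp_apply, r, b.constr_basis, Submodule.subtype_apply]
    rw [hw, ht]
  let E : V →ₗ[F] W := LinearMap.ofIsCompl hC q.toFun r
  have hEq (x : q.domain) : E x = q x := LinearMap.ofIsCompl_apply_left hC x
  have hEt (x : V) : g (E x) = t x := by
    obtain ⟨y, hy, c, hc, rfl⟩ : ∃ y ∈ q.domain, ∃ c ∈ C, y + c = x :=
      Submodule.mem_sup.1 (hC.sup_eq_top ▸ Submodule.mem_top)
    rw [map_add, map_add, map_add]
    congr 1
    · exact (congrArg g (hEq ⟨y, hy⟩)).trans (hqt ⟨y, hy⟩)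
    · exact (congrArg g (LinearMap.ofIsCompl_apply_right hC ⟨c, hc⟩)).trans
        (LinearMap.congr_fun hr ⟨c, hc⟩)
  have hE₁ (x : LinearMap.range f) : E x = e' x :=
    (hEq ⟨x, Submodule.mem_sup_left x.2⟩).trans
      ((LinearPMap.left_le_sup q₁ q₂ hq).2 (x := x) rfl).symm
  have hE₂ (x : LinearMap.ker f) : E x = k x :=
    (hEq ⟨x, Submodule.mem_sup_right x.2⟩).trans
      ((LinearPMap.right_le_sup q₁ q₂ hq).2 (x := x) rfl).symm
  have hEinj : Function.Injective E := by
    rw [injective_iff_map_eq_zero]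
    intro x hx
    have h0 : e' (f.rangeRestrict x) = 0 := Subtype.ext <| by
      rw [Submodule.coe_zero, ← map_zero g, ← hx, hEt]
      rfl
    have hxk : x ∈ LinearMap.ker f := congrArg Subtype.val (e'.map_eq_zero_iff.1 h0)
    have h1 : k ⟨x, hxk⟩ = 0 := Subtype.ext ((hE₂ ⟨x, hxk⟩).symm.trans hx)
    exact congrArg Subtype.val (k.map_eq_zero_iff.1 h1)
  refine ⟨LinearEquiv.ofInjectiveOfFinrankEq E hEinj h, fun x => ?_⟩
  exact (hE₁ ⟨f x, x, rfl⟩).trans (hEt x).symm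

/-- A nilpotent semilinear endomorphism is determined up to isomorphism by the ranks of its
iterates. -/
theorem LinearMap.exists_linearEquiv_of_finrank_span_iterate_eq
    [FiniteDimensional F V] [FiniteDimensional F W]
    (f : V →ₛₗ[σ] V) (g : W →ₛₗ[σ] W) (s : ℕ) (hf : ∀ x, f^[s] x = 0)
    (h : ∀ i, Module.finrank F (Submodule.span F (Set.range f^[i]))
      = Module.finrank F (Submodule.span F (Set.range g^[i]))) :
    ∃ e : V ≃ₗ[F] W, ∀ x, e (f x) = g (e x) := by
  have hVW : Module.finrank F V = Module.finrank F W := by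
    rw [← finrank_span_range_id F V, ← finrank_span_range_id F W]
    exact h 0
  induction s generalizing V W with
  | zero =>
    have hV : Subsingleton V := subsingleton_of_forall_eq 0 hf
    have e : V ≃ₗ[F] W := LinearEquiv.ofFinrankEq V W hVW
    have hW : Subsingleton W := e.symm.toEquiv.subsingleton
    exact ⟨e, fun x => Subsingleton.elim _ _⟩
  | succ s ih =>
    have hf' (x : LinearMap.range f) : f.restrictRange^[s] x = 0 := by
      obtain ⟨_, x, rfl⟩ := x
      exact Subtype.ext ((f.coe_restrictRange_iterate s _).trans (hf x))
    have h' (i : ℕ) := (f.finrank_span_restrictRange_iterate i).trans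
      ((h (i + 1)).trans (g.finrank_span_restrictRange_iterate i).symm)
    obtain ⟨e', he'⟩ := ih f.restrictRange g.restrictRange hf' h'  <| by
      rw [← finrank_span_range_id F (LinearMap.range f), ← finrank_span_range_id F (LinearMap.range g)]
      exact h' 0
    exact LinearMap.exists_linearEquiv_of_range f g hVW e' he'

end Semilinear
namespace RestrictedLieAlgebra

section FrobeniusSemilinear

variable {p : ℕ} {F L : Type*} [Field F] [LieRing L] [LieAlgebra F L]
  [RestrictedLieAlgebra p F L]

theorem IsPNilpotent.exists_iterate_eq_zero (h : IsPNilpotent p F L) :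
    ∃ s : ℕ, ∀ x : L, (pmap p F L)^[s] x = 0 := by
  obtain ⟨s, hs⟩ := h
  have hmem (i : ℕ) (x : L) : (pmap p F L)^[i] x ∈ (subPPow p F)^[i] (⊤ : LieSubalgebra F L) := by
    induction i with
    | zero => trivial
    | succ i ih =>
      rw [Function.iterate_succ_apply', Function.iterate_succ_apply', subPPow, restrictedClosure,
        ← SetLike.mem_coe, LieSubalgebra.coe_sInf, Set.mem_iInter₂]
      exact fun K hK => hK.1 ⟨_, ih, rfl⟩
  refine ⟨s, fun x => ?_⟩
  rw [← LieSubalgebra.mem_bot (R := F), ← hs]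
  exact hmem s x

variable [Fact p.Prime] [CharP F p]

variable (p F L) in
/-- The `p`-map of an abelian restricted Lie algebra as a Frobenius-semilinear map. -/
noncomputable def pmapₛₗ [IsLieAbelian L] : L →ₛₗ[frobenius F p] L where
  toFun := pmap p F L
  map_add' := pmap_add
  map_smul' := pOp_smul

theorem uemb_injective_of_commute (hcomm : ∀ a b : uEnv p F L, a * b = b * a) :
    Function.Injective (uemb p F L) :=
  uemb_injective_of_class_two (lie_lie_eq_zero_of_commute hcomm)

/-- A restricted Lie algebra whose restricted enveloping algebra is commutative is abelian. -/
theorem isLieAbelian_of_commute (hcomm : ∀ a b : uEnv p F L, a * b = b * a) : IsLieAbelian L :=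
  ⟨fun x y => uemb_injective_of_commute hcomm <| by rw [uemb_lie, hcomm, sub_self, map_zero]⟩

end FrobeniusSemilinear

end RestrictedLieAlgebra

open RestrictedLieAlgebra in
/-- If `L` is a finite-dimensional `p`-nilpotent abelian restricted Lie algebra over a
perfect field `F` of characteristic `p > 0` and `H` is a restricted Lie algebra with
`u(L) ≅ u(H)` as `F`-algebras, then `L ≅ H` as restricted Lie algebras. -/
theorem abelian_pnilpotent_determined
    (p : ℕ) (F L H : Type*) [Field F] [Fact p.Prime] [CharP F p] [PerfectField F]
    [LieRing L] [LieAlgebra F L] [RestrictedLieAlgebra p F L]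
    [LieRing H] [LieAlgebra F H] [RestrictedLieAlgebra p F H]
    [FiniteDimensional F L] [IsLieAbelian L]
    (hL : IsPNilpotent p F L)
    (hiso : Nonempty (uEnv p F L ≃ₐ[F] uEnv p F H)) :
    ∃ e : L ≃ₗ[F] H,
      (∀ x y : L, e ⁅x, y⁆ = ⁅e x, e y⁆) ∧
      (∀ x : L, e (pmap p F L x) = pmap p F H (e x)) := by
  have : PerfectRing F p := PerfectField.toPerfectRing p
  have : RingHomSurjective (frobenius F p) := ⟨surjective_frobenius F p⟩
  obtain ⟨A, _, _, ⟨eL⟩⟩ := exists_commRing_algEquiv p F L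
  obtain ⟨θ⟩ := hiso
  let eH : uEnv p F H ≃ₐ[F] A := θ.symm.trans eL
  have hcomm (a b : uEnv p F H) : a * b = b * a :=
    eH.injective (by rw [map_mul, map_mul, mul_comm])
  have : IsLieAbelian H := isLieAbelian_of_commute hcomm
  have : FiniteDimensional F A := finiteDimensional_of_algEquiv eL
  have : FiniteDimensional F H :=
    FiniteDimensional.of_injective (eH.toLinearMap ∘ₗ uemb p F H)
      (eH.injective.comp (uemb_injective_of_commute hcomm))
  obtain ⟨s, hs⟩ := hL.exists_iterate_eq_zero
  obtain ⟨e, he⟩ := LinearMap.exists_linearEquiv_of_finrank_span_iterate_eq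
    (pmapₛₗ p F L) (pmapₛₗ p F H) s hs fun i =>
      Nat.pow_right_injective (Fact.out : p.Prime).two_le
        ((finrank_span_pow eL i).symm.trans (finrank_span_pow eH i))
  refine ⟨e, fun x y => ?_, he⟩
  rw [trivial_lie_zero, trivial_lie_zero, map_zero]
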